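/- arXiv:2002.00724 — 2 statements merged into one kernel-verified Lean document; each statement's English description precedes it below -/
import Mathlib

section
/- Let (N, M) be a pair of real random variables whose joint distribution is a centered bivariate Gaussian in which N and M each have variance 1 and the correlation of N and M is ρ ∈ [-1, 1]. Then E[sign(N)·sign(M)] = 2·P(N·M > 0) − 1 = (2/π)·arcsin(ρ), where sign(x) equals 1 if x > 0, −1 if x < 0, and 0 if x = 0. -/
open MeasureTheory ProbabilityTheory Real

/-- `(N, M)` is a standardized bivariate Gaussian pair with correlation `ρ`:
the joint law is a centered Gaussian on `ℝ²` with `E[N²] = E[M²] = 1` and `E[N·M] = ρ`,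
characterized (Cramér–Wold) by every linear combination `a·N + b·M` being a centered
Gaussian with variance `a² + 2abρ + b²`. -/
def IsStdBivariateGaussian {Ω : Type*} [MeasureSpace Ω] (N M : Ω → ℝ) (ρ : ℝ) : Prop :=
  ∀ a b : ℝ,
    Measure.map (fun ω => a * N ω + b * M ω) ℙ =
      gaussianReal 0 (a ^ 2 + 2 * a * b * ρ + b ^ 2).toNNReal

theorem measurable_real_sign : Measurable Real.sign := by
  unfold Real.sign
  exact Measurable.ite measurableSet_Iio measurable_const
    (Measurable.ite measurableSet_Ioi measurable_const measurable_const)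

theorem abs_real_sign_le_one (x : ℝ) : |Real.sign x| ≤ 1 := by
  rcases Real.sign_apply_eq x with h | h | h <;> simp [h]

theorem real_sign_mul_of_pos {r : ℝ} (hr : 0 < r) (x : ℝ) :
    Real.sign (r * x) = Real.sign x := by
  have hneg : r * x < 0 ↔ x < 0 := smul_neg_iff_of_pos_left hr
  simp only [Real.sign, hneg, mul_pos_iff_of_pos_left hr]

theorem real_sign_mul (x y : ℝ) : Real.sign (x * y) = Real.sign x * Real.sign y := by
  rcases lt_trichotomy x 0 with hx | rfl | hx
  · rw [← neg_mul_neg, real_sign_mul_of_pos (neg_pos.2 hx), Real.sign_neg, Real.sign_of_neg hx,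
      neg_one_mul]
  · simp
  · rw [real_sign_mul_of_pos hx, Real.sign_of_pos hx, one_mul]

/-- A linear combination of two independent standard Gaussians is Gaussian. -/
theorem map_linear_gaussianReal_prod (c d : ℝ) :
    ((gaussianReal 0 1).prod (gaussianReal 0 1)).map (fun p : ℝ × ℝ => c * p.1 + d * p.2) =
      gaussianReal 0 (c ^ 2 + d ^ 2).toNNReal := by
  have h := gaussianReal_add_gaussianReal_of_indepFun
    (P := (gaussianReal 0 1).prod (gaussianReal 0 1))
    (X := fun p : ℝ × ℝ => c * p.1) (Y := fun p : ℝ × ℝ => d * p.2)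
    (m₁ := c * 0) (m₂ := d * 0) (v₁ := .mk (c ^ 2) (sq_nonneg _) * 1)
    (v₂ := .mk (d ^ 2) (sq_nonneg _) * 1)
    (indepFun_prod (X := fun x : ℝ => c * x) (Y := fun x : ℝ => d * x)
      (by fun_prop) (by fun_prop)) ?_ ?_
  · have hv : (c ^ 2 + d ^ 2).toNNReal =
        NNReal.mk (c ^ 2) (sq_nonneg _) * 1 + NNReal.mk (d ^ 2) (sq_nonneg _) * 1 := by
      ext
      simp [Real.coe_toNNReal _ (add_nonneg (sq_nonneg c) (sq_nonneg d))]
    rw [hv]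
    simpa only [mul_zero, add_zero] using! h
  · rw [← gaussianReal_map_const_mul, ← Function.comp_def (fun x : ℝ => c * x) Prod.fst,
      ← Measure.map_map (by fun_prop) (by fun_prop), Measure.map_fst_prod]
    simp
  · rw [← gaussianReal_map_const_mul, ← Function.comp_def (fun x : ℝ => d * x) Prod.snd,
      ← Measure.map_map (by fun_prop) (by fun_prop), Measure.map_snd_prod]
    simp

/-- The Cramér–Wold device for probability measures on `ℝ × ℝ`. -/
theorem ext_of_map_linear {μ ν : Measure (ℝ × ℝ)} [IsProbabilityMeasure μ]
    [IsProbabilityMeasure ν]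
    (h : ∀ a b : ℝ, μ.map (fun p => a * p.1 + b * p.2) = ν.map (fun p => a * p.1 + b * p.2)) :
    μ = ν := by
  refine Measure.ext_of_charFunDual (funext fun L => ?_)
  have hL : (L : ℝ × ℝ → ℝ) = fun p => L (1, 0) * p.1 + L (0, 1) * p.2 := by
    funext p
    have hp : p = p.1 • ((1 : ℝ), (0 : ℝ)) + p.2 • ((0 : ℝ), (1 : ℝ)) := by
      ext <;> simp
    conv_lhs => rw [hp, map_add, map_smul, map_smul]
    simp [mul_comm]
  rw [charFunDual_eq_charFun_map_one, charFunDual_eq_charFun_map_one, hL, h]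

namespace IsStdBivariateGaussian

variable {Ω : Type*} [MeasureSpace Ω] {N M : Ω → ℝ} {ρ : ℝ}

theorem map_fst (h : IsStdBivariateGaussian N M ρ) :
    Measure.map N ℙ = gaussianReal 0 1 := by
  simpa using h 1 0

theorem map_snd (h : IsStdBivariateGaussian N M ρ) :
    Measure.map M ℙ = gaussianReal 0 1 := by
  simpa using h 0 1

theorem aemeasurable_fst (h : IsStdBivariateGaussian N M ρ) : AEMeasurable N ℙ :=
  AEMeasurable.of_map_ne_zero (by simp [h.map_fst, NeZero.ne])

theorem aemeasurable_snd (h : IsStdBivariateGaussian N M ρ) : AEMeasurable M ℙ :=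
  AEMeasurable.of_map_ne_zero (by simp [h.map_snd, NeZero.ne])

/-- The joint law, as the image of two independent standard Gaussians. -/
theorem map_prodMk [IsProbabilityMeasure (ℙ : Measure Ω)] {α : ℝ}
    (h : IsStdBivariateGaussian N M (sin α)) :
    Measure.map (fun ω => (N ω, M ω)) ℙ =
      ((gaussianReal 0 1).prod (gaussianReal 0 1)).map
        (fun p : ℝ × ℝ => (p.1, sin α * p.1 + cos α * p.2)) := by
  have hNM : AEMeasurable (fun ω => (N ω, M ω)) ℙ :=
    h.aemeasurable_fst.prodMk h.aemeasurable_snd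
  have hT : Measurable (fun p : ℝ × ℝ => (p.1, sin α * p.1 + cos α * p.2)) := by fun_prop
  have := Measure.isProbabilityMeasure_map hNM
  have := Measure.isProbabilityMeasure_map
    (μ := (gaussianReal 0 1).prod (gaussianReal 0 1)) hT.aemeasurable
  refine ext_of_map_linear fun a b => ?_
  rw [AEMeasurable.map_map_of_aemeasurable (by fun_prop) hNM, Measure.map_map (by fun_prop) hT]
  refine (h a b).trans ?_
  have hcomp : (fun p : ℝ × ℝ => a * p.1 + b * p.2) ∘
      (fun p : ℝ × ℝ => (p.1, sin α * p.1 + cos α * p.2)) =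
      fun p => (a + b * sin α) * p.1 + (b * cos α) * p.2 := by
    funext p
    simp only [Function.comp]
    ring
  rw [hcomp, map_linear_gaussianReal_prod]
  congr 2
  linear_combination (-b ^ 2) * sin_sq_add_cos_sq α

end IsStdBivariateGaussian

/-- Polar coordinates for the standard Gaussian on the plane, up to the radial constant. -/
theorem exists_integral_gaussianReal_prod_eq :
    ∃ C : ℝ, ∀ g : ℝ × ℝ → ℝ, (∀ r : ℝ, 0 < r → ∀ p, g (r • p) = g p) →
      ∫ p, g p ∂((gaussianReal 0 1).prod (gaussianReal 0 1)) =
        C * ∫ t in (-π)..π, g (cos t, sin t) := by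
  refine ⟨∫ r in Set.Ioi (0 : ℝ), r * ((2 * π)⁻¹ * exp (-r ^ 2 / 2)), fun g hg => ?_⟩
  have hdens : (gaussianReal 0 1).prod (gaussianReal 0 1) =
      (volume : Measure (ℝ × ℝ)).withDensity
        (fun p => gaussianPDF 0 1 p.1 * gaussianPDF 0 1 p.2) := by
    rw [gaussianReal_of_var_ne_zero _ one_ne_zero,
      prod_withDensity (measurable_gaussianPDF _ _) (measurable_gaussianPDF _ _)]
    rfl
  have hm : Measurable (fun p : ℝ × ℝ => gaussianPDF 0 1 p.1 * gaussianPDF 0 1 p.2) :=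
    ((measurable_gaussianPDF _ _).comp measurable_fst).mul
      ((measurable_gaussianPDF _ _).comp measurable_snd)
  rw [hdens, integral_withDensity_eq_integral_toReal_smul hm
    (ae_of_all _ fun _ => ENNReal.mul_lt_top gaussianPDF_lt_top gaussianPDF_lt_top),
    ← integral_comp_polarCoord_symm, polarCoord_target,
    intervalIntegral.integral_of_le (by linarith [pi_pos]), integral_Ioc_eq_integral_Ioo,
    Measure.volume_eq_prod,
    ← setIntegral_prod_mul (fun r : ℝ => r * ((2 * π)⁻¹ * exp (-r ^ 2 / 2)))
      (fun t : ℝ => g (cos t, sin t))]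
  refine setIntegral_congr_fun (measurableSet_Ioi.prod measurableSet_Ioo) fun p hp => ?_
  have hr : 0 < p.1 := hp.1
  have hgp : g (p.1 * cos p.2, p.1 * sin p.2) = g (cos p.2, sin p.2) := hg p.1 hr (_, _)
  simp only [polarCoord_symm_apply, ENNReal.toReal_mul, toReal_gaussianPDF, smul_eq_mul, hgp,
    gaussianPDFReal, NNReal.coe_one, mul_one, sub_zero]
  have hexp : exp (-(p.1 * cos p.2) ^ 2 / 2) * exp (-(p.1 * sin p.2) ^ 2 / 2) =
      exp (-p.1 ^ 2 / 2) := by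
    rw [← exp_add]
    congr 1
    linear_combination (-p.1 ^ 2 / 2) * sin_sq_add_cos_sq p.2
  have hsqrt : (√(2 * π))⁻¹ * (√(2 * π))⁻¹ = (2 * π)⁻¹ := by
    rw [← mul_inv, mul_self_sqrt (by positivity)]
  rw [← hexp, ← hsqrt]
  ring

/-- Integral of a function on the plane, homogeneous of degree zero, against the standard
Gaussian measure. -/
theorem integral_gaussianReal_prod_of_homogeneous {g : ℝ × ℝ → ℝ}
    (hg : ∀ r : ℝ, 0 < r → ∀ p, g (r • p) = g p) :
    ∫ p, g p ∂((gaussianReal 0 1).prod (gaussianReal 0 1)) =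
      (2 * π)⁻¹ * ∫ t in (-π)..π, g (cos t, sin t) := by
  obtain ⟨C, hC⟩ := exists_integral_gaussianReal_prod_eq
  have h1 := hC (fun _ => 1) (fun _ _ _ => rfl)
  have hC' : C = (2 * π)⁻¹ := by
    refine eq_inv_of_mul_eq_one_left ?_
    simp at h1
    linarith
  rw [hC g hg, hC']

theorem integral_sign_cos_mul_sign_sin {α : ℝ} (h1 : -(π / 2) ≤ α) (h2 : α ≤ π / 2) :
    ∫ t in (-π)..π, Real.sign (cos t) * Real.sign (sin (α + t)) = 4 * α := by
  set F : ℝ → ℝ := fun t => Real.sign (cos t) * Real.sign (sin (α + t)) with hF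
  have hFm : Measurable F :=
    (measurable_real_sign.comp (by fun_prop)).mul (measurable_real_sign.comp (by fun_prop))
  have hFi : ∀ a b : ℝ, IntervalIntegrable F volume a b := fun a b => by
    refine (intervalIntegrable_const (c := (1 : ℝ))).mono_fun hFm.aestronglyMeasurable
      (ae_of_all _ fun t => ?_)
    simpa [hF, abs_mul] using
      mul_le_one₀ (abs_real_sign_le_one (cos t)) (abs_nonneg _)
        (abs_real_sign_le_one (sin (α + t)))
  have hper : Function.Periodic F π := fun t => by
    simp only [hF, ← add_assoc, cos_add_pi, sin_add_pi, Real.sign_neg, neg_mul_neg]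
  have hA : ∫ t in (-(π / 2))..(-α), F t = α - π / 2 := by
    have : ∫ t in (-(π / 2))..(-α), F t = ∫ t in (-(π / 2))..(-α), (-1 : ℝ) := by
      rw [intervalIntegral.integral_of_le (by linarith), intervalIntegral.integral_of_le
        (by linarith), integral_Ioc_eq_integral_Ioo, integral_Ioc_eq_integral_Ioo]
      refine setIntegral_congr_fun measurableSet_Ioo fun t ht => ?_
      simp only [hF]
      rw [Real.sign_of_pos (cos_pos_of_mem_Ioo ⟨ht.1, by linarith [ht.2]⟩),
        Real.sign_of_neg (sin_neg_of_neg_of_neg_pi_lt (by linarith [ht.2])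
          (by linarith [ht.1]))]
      ring
    rw [this, intervalIntegral.integral_const, smul_eq_mul]
    ring
  have hB : ∫ t in (-α)..(π / 2), F t = α + π / 2 := by
    have : ∫ t in (-α)..(π / 2), F t = ∫ t in (-α)..(π / 2), (1 : ℝ) := by
      rw [intervalIntegral.integral_of_le (by linarith), intervalIntegral.integral_of_le
        (by linarith), integral_Ioc_eq_integral_Ioo, integral_Ioc_eq_integral_Ioo]
      refine setIntegral_congr_fun measurableSet_Ioo fun t ht => ?_
      simp only [hF]
      rw [Real.sign_of_pos (cos_pos_of_mem_Ioo ⟨by linarith [ht.1], ht.2⟩),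
        Real.sign_of_pos (sin_pos_of_pos_of_lt_pi (by linarith [ht.1]) (by linarith [ht.2]))]
      ring
    rw [this, intervalIntegral.integral_const, smul_eq_mul]
    ring
  have hhalf : ∫ t in (-(π / 2))..(π / 2), F t = 2 * α := by
    rw [← intervalIntegral.integral_add_adjacent_intervals (hFi _ (-α)) (hFi _ _), hA, hB]
    ring
  have hshift : ∀ s, ∫ t in s..(s + π), F t = 2 * α := fun s => by
    rw [hper.intervalIntegral_add_eq s (-(π / 2)), ← hhalf]
    congr 1
    ring
  have hl := hshift (-π)
  have hr := hshift 0
  rw [neg_add_cancel] at hl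
  rw [zero_add] at hr
  rw [← intervalIntegral.integral_add_adjacent_intervals (hFi _ 0) (hFi _ _), hl, hr]
  ring

namespace IsStdBivariateGaussian

variable {Ω : Type*} [MeasureSpace Ω] {N M : Ω → ℝ} {ρ : ℝ}

theorem integral_sign_mul_sign [IsProbabilityMeasure (ℙ : Measure Ω)]
    (h : IsStdBivariateGaussian N M ρ)
    (hρ : ρ ∈ Set.Icc (-1 : ℝ) 1) :
    ∫ ω, Real.sign (N ω) * Real.sign (M ω) ∂ℙ = 2 / π * Real.arcsin ρ := by
  set α := arcsin ρ with hα
  have hsin : sin α = ρ := sin_arcsin hρ.1 hρ.2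
  rw [← hsin] at h
  have hm : Measurable (fun p : ℝ × ℝ => Real.sign p.1 * Real.sign p.2) :=
    (measurable_real_sign.comp measurable_fst).mul (measurable_real_sign.comp measurable_snd)
  rw [← integral_map (h.aemeasurable_fst.prodMk h.aemeasurable_snd)
      (f := fun p : ℝ × ℝ => Real.sign p.1 * Real.sign p.2) hm.aestronglyMeasurable,
    h.map_prodMk, integral_map (by fun_prop) hm.aestronglyMeasurable,
    integral_gaussianReal_prod_of_homogeneous]
  · simp only [← sin_add]
    rw [integral_sign_cos_mul_sign_sin (neg_pi_div_two_le_arcsin ρ) (arcsin_le_pi_div_two ρ)]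
    field_simp
    ring
  · intro r hr p
    have : sin α * (r * p.1) + cos α * (r * p.2) = r * (sin α * p.1 + cos α * p.2) := by ring
    simp only [Prod.smul_fst, Prod.smul_snd, smul_eq_mul, this, real_sign_mul_of_pos hr]

theorem ae_mul_ne_zero (h : IsStdBivariateGaussian N M ρ) : ∀ᵐ ω ∂ℙ, N ω * M ω ≠ 0 := by
  have key : ∀ {X : Ω → ℝ}, AEMeasurable X ℙ → Measure.map X ℙ = gaussianReal 0 1 →
      ∀ᵐ ω ∂ℙ, X ω ≠ 0 := fun {X} hX hmap => by
    have := nullSingletonClass_gaussianReal (μ := 0) (v := 1) one_ne_zero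
    refine ae_of_ae_map hX (p := fun x => x ≠ 0) ?_
    rw [hmap]
    exact Measure.ae_ne _ 0
  filter_upwards [key h.aemeasurable_fst h.map_fst, key h.aemeasurable_snd h.map_snd]
    with ω h1 h2 using mul_ne_zero h1 h2

theorem integral_sign_mul_sign_eq_prob [IsProbabilityMeasure (ℙ : Measure Ω)]
    (h : IsStdBivariateGaussian N M ρ) :
    ∫ ω, Real.sign (N ω) * Real.sign (M ω) ∂ℙ =
      2 * (ℙ {ω | 0 < N ω * M ω}).toReal - 1 := by
  have hs : NullMeasurableSet {ω | 0 < N ω * M ω} ℙ :=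
    nullMeasurableSet_lt aemeasurable_const (h.aemeasurable_fst.mul h.aemeasurable_snd)
  have hae : (fun ω => Real.sign (N ω) * Real.sign (M ω)) =ᵐ[ℙ]
      fun ω => 2 * Set.indicator {ω | 0 < N ω * M ω} (fun _ => (1 : ℝ)) ω - 1 := by
    filter_upwards [h.ae_mul_ne_zero] with ω hω
    rw [← real_sign_mul]
    rcases hω.lt_or_gt with hlt | hgt
    · rw [Real.sign_of_neg hlt, Set.indicator_of_notMem (by simpa using hlt.le)]
      norm_num
    · rw [Real.sign_of_pos hgt, Set.indicator_of_mem (by simpa using hgt)]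
      norm_num
  have hi : Integrable (Set.indicator {ω | 0 < N ω * M ω} (fun _ => (1 : ℝ))) ℙ :=
    (integrable_const 1).indicator₀ hs
  rw [integral_congr_ae hae, integral_sub (hi.const_mul 2) (integrable_const 1),
    integral_const_mul, integral_indicator₀ hs]
  simp [Measure.real]

end IsStdBivariateGaussian

/-- `E[sign(N)·sign(M)] = 2·P(N·M > 0) − 1 = (2/π)·arcsin(ρ)`,
where `Real.sign x` is `1` if `x > 0`, `-1` if `x < 0`, and `0` if `x = 0`. -/
theorem stmt_2 {Ω : Type*} [MeasureSpace Ω] [IsProbabilityMeasure (ℙ : Measure Ω)]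
    (N M : Ω → ℝ) (ρ : ℝ) (hρ : ρ ∈ Set.Icc (-1 : ℝ) 1)
    (hGauss : IsStdBivariateGaussian N M ρ) :
    (∫ ω, Real.sign (N ω) * Real.sign (M ω) ∂ℙ) =
        2 * (ℙ {ω | 0 < N ω * M ω}).toReal - 1 ∧
      2 * (ℙ {ω | 0 < N ω * M ω}).toReal - 1 = 2 / π * Real.arcsin ρ := by
  have h := hGauss.integral_sign_mul_sign_eq_prob
  exact ⟨h, h ▸ hGauss.integral_sign_mul_sign hρ⟩
end

section
/- Let W¹ and W³ be independent standard Brownian motions on [0, ∞), let ρ ∈ [−1, 1] and θ ∈ ℝ, and define the lead-lag partner process W²_u := ρ·W¹_{u+θ} + √(1 − ρ²)·W³_{u+θ} for all u with u + θ ≥ 0. For any 0 ≤ a < b and any c < d with c + θ ≥ 0, letting L := max(0, min(b, d + θ) − max(a, c + θ)) denote the length of the overlap of [a, b] and [c + θ, d + θ], the probability that the product of increments is positive satisfies P((W¹_b − W¹_a)·(W²_d − W²_c) > 0) = 1/2 + (1/π)·arcsin(ρ·L / √((b − a)·(d − c))). -/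
open MeasureTheory ProbabilityTheory Real

/-- A standard Brownian motion on `[0, ∞)`: a centered Gaussian process with continuous
sample paths and covariance function `Cov(W_s, W_t) = min s t`.  Gaussianity, centering and
the covariance structure are expressed through the law of finite linear combinations. -/
def IsStdBrownianMotion {Ω : Type*} [MeasureSpace Ω] (W : ℝ → Ω → ℝ) : Prop :=
  (∀ ω, ContinuousOn (fun τ => W τ ω) (Set.Ici 0)) ∧
  ∀ (k : ℕ) (c : Fin k → ℝ) (τ : Fin k → ℝ), (∀ i, 0 ≤ τ i) →
    Measure.map (fun ω => ∑ i, c i * W (τ i) ω) ℙ =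
      gaussianReal 0 (∑ i, ∑ j, c i * c j * min (τ i) (τ j)).toNNReal

/-- `W₁` and `W₃` are independent standard Brownian motions on `[0, ∞)`: each is a standard
Brownian motion and they are jointly Gaussian with zero cross-covariance, expressed through
the law of finite linear combinations of values of both processes. -/
def AreIndepStdBrownianMotions {Ω : Type*} [MeasureSpace Ω] (W₁ W₃ : ℝ → Ω → ℝ) : Prop :=
  IsStdBrownianMotion W₁ ∧ IsStdBrownianMotion W₃ ∧
  ∀ (k l : ℕ) (c : Fin k → ℝ) (e : Fin l → ℝ) (τ : Fin k → ℝ) (υ : Fin l → ℝ),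
    (∀ i, 0 ≤ τ i) → (∀ j, 0 ≤ υ j) →
    Measure.map (fun ω => (∑ i, c i * W₁ (τ i) ω) + ∑ j, e j * W₃ (υ j) ω) ℙ =
      gaussianReal 0 ((∑ i, ∑ j, c i * c j * min (τ i) (τ j)) +
        ∑ i, ∑ j, e i * e j * min (υ i) (υ j)).toNNReal

/-- The covariance of two real random variables. -/
noncomputable def cov {Ω : Type*} [MeasureSpace Ω] (X Y : Ω → ℝ) : ℝ :=
  ∫ ω, (X ω - ∫ ω', X ω' ∂ℙ) * (Y ω - ∫ ω', Y ω' ∂ℙ) ∂ℙ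

/-- The standard Gaussian measure of a planar cone is proportional to its angular measure. -/
lemma gaussianReal_prod_cone {S : Set (ℝ × ℝ)} (hS : MeasurableSet S) {A : Set ℝ}
    (hA : MeasurableSet A)
    (h : ∀ r > 0, ∀ α ∈ Set.Ioo (-π) π, (r * cos α, r * sin α) ∈ S ↔ α ∈ A) :
    ((gaussianReal 0 1).prod (gaussianReal 0 1)) S =
      (∫⁻ r in Set.Ioi (0 : ℝ),
          ENNReal.ofReal r * ENNReal.ofReal ((2 * π)⁻¹ * exp (-(r ^ 2 / 2)))) *
        volume (A ∩ Set.Ioo (-π) π) := by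
  have hdens : ∀ x y : ℝ, gaussianPDF 0 1 x * gaussianPDF 0 1 y =
      ENNReal.ofReal ((2 * π)⁻¹ * exp (-((x ^ 2 + y ^ 2) / 2))) := by
    intro x y
    rw [gaussianPDF, gaussianPDF, ← ENNReal.ofReal_mul (gaussianPDFReal_nonneg _ _ _)]
    congr 1
    simp only [gaussianPDFReal, NNReal.coe_one, mul_one, sub_zero]
    rw [mul_mul_mul_comm, ← exp_add, ← mul_inv, mul_self_sqrt (by positivity)]
    congr 2
    ring
  rw [gaussianReal_of_var_ne_zero _ one_ne_zero,
    prod_withDensity (measurable_gaussianPDF _ _) (measurable_gaussianPDF _ _),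
    withDensity_apply _ hS, ← lintegral_indicator hS]
  have hpolar := lintegral_comp_polarCoord_symm (S.indicator fun p : ℝ × ℝ =>
    gaussianPDF 0 1 p.1 * gaussianPDF 0 1 p.2)
  rw [Measure.volume_eq_prod] at hpolar
  rw [← hpolar, polarCoord_target]
  have hcongr : ∀ p ∈ Set.Ioi (0 : ℝ) ×ˢ Set.Ioo (-π) π,
      ENNReal.ofReal p.1 • S.indicator (fun p : ℝ × ℝ => gaussianPDF 0 1 p.1 * gaussianPDF 0 1 p.2)
        (polarCoord.symm p) =
      (ENNReal.ofReal p.1 * ENNReal.ofReal ((2 * π)⁻¹ * exp (-(p.1 ^ 2 / 2)))) *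
        A.indicator 1 p.2 := by
    rintro ⟨r, α⟩ ⟨hr, hα⟩
    have := h r hr α hα
    by_cases hmem : α ∈ A
    · simp only [polarCoord_symm_apply, smul_eq_mul, Set.indicator_of_mem (this.2 hmem),
        Set.indicator_of_mem hmem, hdens, Pi.one_apply, mul_one, mul_pow, ← mul_add,
        cos_sq_add_sin_sq]
    · simp only [polarCoord_symm_apply, Set.indicator_of_notMem (mt this.1 hmem),
        Set.indicator_of_notMem hmem, smul_zero, mul_zero]
  rw [setLIntegral_congr_fun (measurableSet_Ioi.prod measurableSet_Ioo) hcongr,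
    ← Measure.prod_restrict,
    lintegral_prod_mul
      (f := fun r => ENNReal.ofReal r * ENNReal.ofReal ((2 * π)⁻¹ * exp (-(r ^ 2 / 2))))
      (by fun_prop) (measurable_one.indicator hA).aemeasurable, lintegral_indicator_one hA,
    Measure.restrict_apply hA]

lemma measurableSet_wedge (φ : ℝ) :
    MeasurableSet {p : ℝ × ℝ | 0 < p.1 ∧ 0 < sin φ * p.1 + cos φ * p.2} :=
  (measurableSet_lt measurable_const measurable_fst).inter
    (measurableSet_lt (f := fun _ : ℝ × ℝ => (0 : ℝ))
      (g := fun p => sin φ * p.1 + cos φ * p.2) measurable_const (by fun_prop))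

/-- A wedge of opening angle `π / 2 + φ` for the standard Gaussian measure on the plane. -/
lemma gaussianReal_prod_wedge {φ : ℝ} (hφ : φ ∈ Set.Icc (-(π / 2)) (π / 2)) :
    ((gaussianReal 0 1).prod (gaussianReal 0 1)).real
      {p | 0 < p.1 ∧ 0 < sin φ * p.1 + cos φ * p.2} = 1 / 4 + φ / (2 * π) := by
  have hπ := pi_pos
  have hwedge := gaussianReal_prod_cone
    (S := {p : ℝ × ℝ | 0 < p.1 ∧ 0 < sin φ * p.1 + cos φ * p.2})
    (A := Set.Ioo (-φ) (π / 2))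
    (measurableSet_wedge φ) measurableSet_Ioo (by
    intro r hr α hα
    have hsum : sin φ * (r * cos α) + cos φ * (r * sin α) = r * sin (φ + α) := by
      rw [sin_add]; ring
    simp only [Set.mem_ofPred_eq, hsum, mul_pos_iff_of_pos_left hr, Set.mem_Ioo]
    obtain ⟨h1, h2⟩ := hα
    obtain ⟨h3, h4⟩ := hφ
    constructor
    · rintro ⟨hc, hs⟩
      have hα2 : α < π / 2 := by
        by_contra! hge
        exact hc.not_ge (cos_nonpos_of_pi_div_two_le_of_le hge (by linarith))
      have hα1 : -(π / 2) < α := by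
        by_contra! hge
        rw [← cos_neg] at hc
        exact hc.not_ge (cos_nonpos_of_pi_div_two_le_of_le (by linarith) (by linarith))
      refine ⟨?_, hα2⟩
      by_contra! hge
      exact hs.not_ge (sin_nonpos_of_nonpos_of_neg_pi_le (by linarith) (by linarith))
    · rintro ⟨hl, hu⟩
      exact ⟨cos_pos_of_mem_Ioo ⟨by linarith, hu⟩,
        sin_pos_of_pos_of_lt_pi (by linarith) (by linarith)⟩)
  have htotal := gaussianReal_prod_cone (S := Set.univ) (A := Set.univ) .univ .univ (by simp)
  rw [measure_univ, Set.univ_inter, Real.volume_Ioo] at htotal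
  have hinter : Set.Ioo (-φ) (π / 2) ∩ Set.Ioo (-π) π = Set.Ioo (-φ) (π / 2) :=
    Set.inter_eq_left.2 (Set.Ioo_subset_Ioo (by linarith [hφ.2]) (by linarith))
  rw [hinter, Real.volume_Ioo] at hwedge
  have htotal' := congrArg ENNReal.toReal htotal
  rw [ENNReal.toReal_one, ENNReal.toReal_mul, ENNReal.toReal_ofReal (by linarith)] at htotal'
  rw [measureReal_def, hwedge, ENNReal.toReal_mul, ENNReal.toReal_ofReal (by linarith [hφ.1])]
  have hR := eq_div_of_mul_eq (by linarith : 0 < π - -π).ne' htotal'.symm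
  rw [hR]
  field_simp
  ring

/-- Both coordinates of a pair of standard Gaussians with correlation `sin φ` have the same sign
with probability `1 / 2 + φ / π`. -/
lemma gaussianReal_prod_sameSign {φ : ℝ} (hφ : φ ∈ Set.Icc (-(π / 2)) (π / 2)) :
    ((gaussianReal 0 1).prod (gaussianReal 0 1)).real
      {p | 0 < p.1 * (sin φ * p.1 + cos φ * p.2)} = 1 / 2 + φ / π := by
  have hS := measurableSet_wedge φ
  have hneg : ((gaussianReal 0 1).prod (gaussianReal 0 1)).map
      (Prod.map (fun x => -x) (fun x => -x)) = (gaussianReal 0 1).prod (gaussianReal 0 1) := by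
    rw [← Measure.map_prod_map _ _ measurable_neg measurable_neg, gaussianReal_map_neg, neg_zero]
  have hsplit : {p : ℝ × ℝ | 0 < p.1 * (sin φ * p.1 + cos φ * p.2)} =
      {p | 0 < p.1 ∧ 0 < sin φ * p.1 + cos φ * p.2} ∪
        Prod.map (fun x => -x) (fun x => -x) ⁻¹'
          {p | 0 < p.1 ∧ 0 < sin φ * p.1 + cos φ * p.2} := by
    ext p
    have : sin φ * -p.1 + cos φ * -p.2 = -(sin φ * p.1 + cos φ * p.2) := by ring
    simp only [Set.mem_ofPred_eq, Set.mem_union, Set.mem_preimage, Prod.map_fst, Prod.map_snd, this,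
      neg_pos, mul_pos_iff]
  have hdisj : Disjoint {p : ℝ × ℝ | 0 < p.1 ∧ 0 < sin φ * p.1 + cos φ * p.2}
      (Prod.map (fun x => -x) (fun x => -x) ⁻¹'
          {p : ℝ × ℝ | 0 < p.1 ∧ 0 < sin φ * p.1 + cos φ * p.2}) := by
    refine Set.disjoint_left.2 fun p hp hp' => ?_
    have h1 : 0 < p.1 := hp.1
    have h2 : 0 < -p.1 := hp'.1
    linarith
  have hmeas : Measurable (Prod.map (fun x : ℝ => -x) (fun x : ℝ => -x)) :=
    measurable_neg.prodMap measurable_neg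
  rw [hsplit, measureReal_union hdisj (hmeas hS), ← map_measureReal_apply hmeas hS, hneg,
    gaussianReal_prod_wedge hφ]
  field_simp
  ring

/-- Sheppard's formula: for a centered Gaussian vector `(X, Y)` with variances `σ ^ 2`, `τ ^ 2` and
covariance `κ`, the probability that `X` and `Y` have the same sign. -/
lemma measureReal_mul_pos_of_gaussian {Ω : Type*} [MeasurableSpace Ω] {μ : Measure Ω}
    [IsProbabilityMeasure μ] {X Y : Ω → ℝ} {σ τ κ : ℝ} (hσ : 0 < σ) (hτ : 0 < τ)
    (hκ : |κ| ≤ σ * τ)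
    (hlaw : ∀ s t : ℝ, μ.map (fun ω => s * X ω + t * Y ω) =
      gaussianReal 0 (s ^ 2 * σ ^ 2 + 2 * s * t * κ + t ^ 2 * τ ^ 2).toNNReal) :
    μ.real {ω | 0 < X ω * Y ω} = 1 / 2 + 1 / π * arcsin (κ / (σ * τ)) := by
  have haem : ∀ s t : ℝ, AEMeasurable (fun ω => s * X ω + t * Y ω) μ := fun s t =>
    AEMeasurable.of_map_ne_zero (by rw [hlaw]; exact IsProbabilityMeasure.ne_zero _)
  have hX : AEMeasurable X μ := by simpa using haem 1 0
  have hY : AEMeasurable Y μ := by simpa using haem 0 1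
  set φ := arcsin (κ / (σ * τ)) with hφ
  have hστ : 0 < σ * τ := mul_pos hσ hτ
  have hsin : σ * τ * sin φ = κ := by
    rw [hφ, sin_arcsin]
    · field_simp
    · rw [le_div_iff₀ hστ]; linarith [(abs_le.1 hκ).1]
    · rw [div_le_one hστ]; exact (abs_le.1 hκ).2
  let T : ℝ × ℝ →L[ℝ] ℝ × ℝ :=
    (σ • ContinuousLinearMap.fst ℝ ℝ ℝ).prod
      (τ • (sin φ • ContinuousLinearMap.fst ℝ ℝ ℝ + cos φ • ContinuousLinearMap.snd ℝ ℝ ℝ))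
  have hT : ∀ p, T p = (σ * p.1, τ * (sin φ * p.1 + cos φ * p.2)) := fun p => by
    simp [T, mul_add]
  have hjoint : μ.map (fun ω => (X ω, Y ω)) =
      ((gaussianReal 0 1).prod (gaussianReal 0 1)).map T := by
    have : IsProbabilityMeasure (μ.map fun ω => (X ω, Y ω)) :=
      Measure.isProbabilityMeasure_map (hX.prodMk hY)
    refine Measure.ext_of_charFunDual ?_
    ext L
    have hL : ∀ x y, L (x, y) = L (1, 0) * x + L (0, 1) * y := fun x y => by
      have : (x, y) = x • ((1 : ℝ), (0 : ℝ)) + y • ((0 : ℝ), (1 : ℝ)) := by simp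
      rw [this, map_add, map_smul, map_smul, smul_eq_mul, smul_eq_mul]; ring
    have hmapL : (μ.map fun ω => (X ω, Y ω)).map L =
        gaussianReal 0 (L (1, 0) ^ 2 * σ ^ 2 + 2 * L (1, 0) * L (0, 1) * κ
          + L (0, 1) ^ 2 * τ ^ 2).toNNReal := by
      rw [← hlaw, AEMeasurable.map_map_of_aemeasurable (by fun_prop) (hX.prodMk hY)]
      congr 1
      ext ω
      exact hL _ _
    have hlin : ∀ f : StrongDual ℝ ℝ,
        charFunDual (gaussianReal 0 1) f = Complex.exp (-((f 1 ^ 2 / 2 : ℝ) : ℂ)) := fun f => by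
      have : ⇑f = fun x => f 1 * x := by
        ext x
        rw [mul_comm, ← smul_eq_mul, ← map_smul, smul_eq_mul, mul_one]
      rw [charFunDual_eq_charFun_map_one, this, gaussianReal_map_const_mul, charFun_gaussianReal]
      congr 1
      simp
    rw [charFunDual_eq_charFun_map_one, hmapL, charFun_gaussianReal, charFunDual_map,
      charFunDual_prod, hlin, hlin, ← Complex.exp_add]
    have h1 : (L ∘SL T ∘SL ContinuousLinearMap.inl ℝ ℝ ℝ) 1 =
        L (1, 0) * σ + L (0, 1) * (τ * sin φ) := by
      simp [hT, hL σ]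
    have h2 : (L ∘SL T ∘SL ContinuousLinearMap.inr ℝ ℝ ℝ) 1 = L (0, 1) * (τ * cos φ) := by
      simp [hT, hL 0 (τ * cos φ)]
    have hvar : L (1, 0) ^ 2 * σ ^ 2 + 2 * L (1, 0) * L (0, 1) * κ + L (0, 1) ^ 2 * τ ^ 2 =
        (L (1, 0) * σ + L (0, 1) * (τ * sin φ)) ^ 2 + (L (0, 1) * (τ * cos φ)) ^ 2 := by
      linear_combination (-2 * L (1, 0) * L (0, 1)) * hsin -
        (L (0, 1) ^ 2 * τ ^ 2) * sin_sq_add_cos_sq φ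
    rw [ContinuousLinearMap.comp_assoc, ContinuousLinearMap.comp_assoc, h1, h2, hvar,
      Real.coe_toNNReal _ (by positivity)]
    congr 1
    push_cast
    ring
  have hQ : MeasurableSet {p : ℝ × ℝ | 0 < p.1 * p.2} :=
    measurableSet_lt measurable_const (by fun_prop)
  have hpre : μ.real {ω | 0 < X ω * Y ω} =
      (μ.map fun ω => (X ω, Y ω)).real {p | 0 < p.1 * p.2} := by
    rw [measureReal_def, measureReal_def, Measure.map_apply_of_aemeasurable (hX.prodMk hY) hQ]
    rfl
  have hset : T ⁻¹' {p | 0 < p.1 * p.2} = {p | 0 < p.1 * (sin φ * p.1 + cos φ * p.2)} := by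
    ext p
    rw [Set.mem_preimage, hT, Set.mem_ofPred_eq, Set.mem_ofPred_eq, mul_mul_mul_comm,
      mul_pos_iff_of_pos_left hστ]
  rw [hpre, hjoint, map_measureReal_apply T.continuous.measurable hQ, hset,
    gaussianReal_prod_sameSign ⟨neg_pi_div_two_le_arcsin _, arcsin_le_pi_div_two _⟩]
  ring

/-- The length of the overlap of two intervals as the covariance of Brownian increments. -/
lemma min_increment_eq_overlap {a b c d : ℝ} (hab : a ≤ b) (hcd : c ≤ d) :
    min b d - min b c - min a d + min a c = max 0 (min b d - max a c) := by
  rcases le_total b d with h1 | h1 <;> rcases le_total b c with h2 | h2 <;>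
    rcases le_total a d with h3 | h3 <;> rcases le_total a c with h4 | h4 <;>
    simp only [min_eq_left, min_eq_right, max_eq_left, max_eq_right, h1, h2, h3, h4] <;>
    grind

/-- The joint law of an increment of the first process and an increment of its lead-lag partner,
through linear combinations. -/
lemma AreIndepStdBrownianMotions.map_increments {Ω : Type*} [MeasureSpace Ω] {W₁ W₃ : ℝ → Ω → ℝ}
    (hBM : AreIndepStdBrownianMotions W₁ W₃) {a b c d : ℝ} (ha : 0 ≤ a) (hab : a ≤ b)
    (hc : 0 ≤ c) (hcd : c ≤ d) (s u v : ℝ) :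
    Measure.map (fun ω => s * (W₁ b ω - W₁ a ω) + (u * (W₁ d ω - W₁ c ω)
        + v * (W₃ d ω - W₃ c ω))) ℙ =
      gaussianReal 0 (s ^ 2 * (b - a) + 2 * s * u * max 0 (min b d - max a c)
        + (u ^ 2 + v ^ 2) * (d - c)).toNNReal := by
  convert! hBM.2.2 4 2 ![s, -s, u, -u] ![v, -v] ![b, a, d, c] ![d, c]
    (by simp [Fin.forall_fin_succ, ha, hc, ha.trans hab, hc.trans hcd])
    (by simp [Fin.forall_fin_succ, hc, hc.trans hcd]) using 2
  · ext ω
    simp [Fin.sum_univ_succ]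
    ring
  · rw [← min_increment_eq_overlap hab hcd]
    simp [Fin.sum_univ_succ, hab, hcd, min_comm d b, min_comm d a, min_comm c b, min_comm c a]
    ring_nf

/-- With `L := max(0, min(b, d + θ) − max(a, c + θ))` the length of the overlap of
`[a, b]` and `[c + θ, d + θ]`, the probability that the product of increments is positive is
`P((W¹_b − W¹_a)·(W²_d − W²_c) > 0) = 1/2 + (1/π)·arcsin(ρ·L / √((b − a)·(d − c)))`. -/
theorem stmt_6 {Ω : Type*} [MeasureSpace Ω] [IsProbabilityMeasure (ℙ : Measure Ω)]
    (W₁ W₃ W₂ : ℝ → Ω → ℝ) (ρ θ : ℝ) (hρ : ρ ∈ Set.Icc (-1 : ℝ) 1)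
    (hBM : AreIndepStdBrownianMotions W₁ W₃)
    (hW₂ : ∀ u : ℝ, 0 ≤ u + θ → ∀ ω,
      W₂ u ω = ρ * W₁ (u + θ) ω + Real.sqrt (1 - ρ ^ 2) * W₃ (u + θ) ω)
    (a b c d : ℝ) (ha : 0 ≤ a) (hab : a < b) (hcd : c < d) (hcθ : 0 ≤ c + θ) :
    (ℙ {ω | 0 < (W₁ b ω - W₁ a ω) * (W₂ d ω - W₂ c ω)}).toReal =
      1 / 2 + (1 / π) * Real.arcsin (ρ * max 0 (min b (d + θ) - max a (c + θ)) /
        Real.sqrt ((b - a) * (d - c))) := by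
  have hab' := sub_pos.2 hab
  have hcd' := sub_pos.2 hcd
  have hlen : d + θ - (c + θ) = d - c := by ring
  set L := max 0 (min b (d + θ) - max a (c + θ)) with hL
  have hL0 : 0 ≤ L := le_max_left _ _
  have hL1 : L ≤ b - a :=
    max_le hab'.le (sub_le_sub (min_le_left _ _) (le_max_left _ _))
  have hL2 : L ≤ d - c :=
    max_le hcd'.le (hlen ▸ sub_le_sub (min_le_right _ _) (le_max_right _ _))
  rw [sqrt_mul hab'.le]
  refine measureReal_mul_pos_of_gaussian (sqrt_pos.2 hab') (sqrt_pos.2 hcd') ?_ fun s t => ?_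
  · rw [← sqrt_mul hab'.le, abs_mul, abs_of_nonneg hL0]
    refine (mul_le_of_le_one_left hL0 (abs_le.2 hρ)).trans (le_sqrt_of_sq_le ?_)
    rw [sq]
    exact mul_le_mul hL1 hL2 hL0 hab'.le
  · have hρ' : √(1 - ρ ^ 2) ^ 2 = 1 - ρ ^ 2 :=
      sq_sqrt (by nlinarith [hρ.1, hρ.2])
    have hlaw := hBM.map_increments ha hab.le hcθ (by linarith : c + θ ≤ d + θ) s (t * ρ)
      (t * √(1 - ρ ^ 2))
    rw [← hL, hlen] at hlaw
    convert! hlaw using 2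
    · ext ω
      rw [hW₂ d (by linarith), hW₂ c hcθ]
      ring
    · rw [sq_sqrt hab'.le, sq_sqrt hcd'.le]
      congr 1
      linear_combination (-t ^ 2 * (d - c)) * hρ'
end
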